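/- Let f be a corner function with nodes z₁ < ⋯ < z_m (m ≥ 1), and let h ∈ PLF⁺([0,1]) be the unique map with single node z_m and h*(z_m) = f*(z_m). Then h f h⁻¹ is again a corner function whose nodes, in increasing order, are h(f⁻¹(z_m)), h(z₁), …, h(z_{m-1}), and the multiset of values of (h f h⁻¹)* at its nodes equals the multiset of values of f* at its nodes: the last node of f becomes the first node of h f h⁻¹ and all other nodes shift one place to the right, with the node values f*(z₁), …, f*(z_m) unchanged. -/

import Mathlib

open Set Function

/-- `f` is locally affine at `x`: it agrees with an affine map on a neighbourhood of `x`. -/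
def LocallyAffineAt (f : ℝ → ℝ) (x : ℝ) : Prop :=
  ∃ a b : ℝ, ∀ᶠ y in nhds x, f y = a * y + b

/-- `x` is a node of `f`: a point of `(0,1)` at which `f` is not locally affine. -/
def IsNode (f : ℝ → ℝ) (x : ℝ) : Prop :=
  x ∈ Set.Ioo (0 : ℝ) 1 ∧ ¬ LocallyAffineAt f x

/-- Membership of the group `PLF⁺([0,1])` of orientation-preserving piecewise linear
homeomorphisms of `[0,1]` that are locally affine at all but finitely many points of `(0,1)`.
Such a homeomorphism is modelled as a map `ℝ → ℝ` that equals the identity outside `[0,1]`,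
so that composition and (function) inverse model the group structure. -/
structure IsPLF (f : ℝ → ℝ) : Prop where
  map_zero : f 0 = 0
  map_one : f 1 = 1
  strictMonoOn : StrictMonoOn f (Set.Icc 0 1)
  continuousOn : ContinuousOn f (Set.Icc 0 1)
  surjOn : Set.SurjOn f (Set.Icc 0 1) (Set.Icc 0 1)
  eq_id : ∀ x : ℝ, x ∉ Set.Icc (0 : ℝ) 1 → f x = x
  finite_nodes : {x : ℝ | IsNode f x}.Finite

/-- Membership of `𝓕`: elements of `PLF⁺([0,1])` with `f x > x` on `(0,1)`. -/
def MemF (f : ℝ → ℝ) : Prop :=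
  IsPLF f ∧ ∀ x ∈ Set.Ioo (0 : ℝ) 1, x < f x

/-- `f` has at least one node. -/
def HasNode (f : ℝ → ℝ) : Prop := ∃ x, IsNode f x

/-- The left derivative `f'₋(x)`. -/
noncomputable def leftDeriv (f : ℝ → ℝ) (x : ℝ) : ℝ := derivWithin f (Set.Iic x) x

/-- The right derivative `f'₊(x)`. -/
noncomputable def rightDeriv (f : ℝ → ℝ) (x : ℝ) : ℝ := derivWithin f (Set.Ici x) x

/-- `f*(x) = f'₊(x) / f'₋(x)`. -/
noncomputable def fstar (f : ℝ → ℝ) (x : ℝ) : ℝ := rightDeriv f x / leftDeriv f x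

/-- `x_f`, the smallest node of `f` (for `f ∈ 𝓕` with at least one node). -/
noncomputable def firstNode (f : ℝ → ℝ) : ℝ := sInf {x | IsNode f x}

/-- `y_f`, the largest node of `f`. -/
noncomputable def lastNode (f : ℝ → ℝ) : ℝ := sSup {x | IsNode f x}

/-- `α_f = f'₋(x_f)`. -/
noncomputable def alphaF (f : ℝ → ℝ) : ℝ := leftDeriv f (firstNode f)

/-- `φ_f^a(x) = ∏_{n=0}^∞ f*(fⁿ(x))` (independent of `a` as a formula; `a` only
fixes the domain `[a, f a)`). -/
noncomputable def phi (f : ℝ → ℝ) (x : ℝ) : ℝ := ∏' n : ℕ, fstar f (f^[n] x)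

/-- `ψ_f^a(s) = φ_f^a(α_f ^ s * a)`, a function on the circle `𝕊 = [0,1]/(0∼1)`,
represented by its values for `s ∈ [0,1)`. -/
noncomputable def psiA (f : ℝ → ℝ) (a s : ℝ) : ℝ := phi f (alphaF f ^ s * a)

/-- `ψ_f = ψ_f^{x_f}`. -/
noncomputable def psi (f : ℝ → ℝ) (s : ℝ) : ℝ := psiA f (firstNode f) s

/-- `f` and `g` are conjugate in `PLF⁺([0,1])`: `h f h⁻¹ = g` for some `h` in the group. -/
def IsConjPLF (f g : ℝ → ℝ) : Prop :=
  ∃ h : ℝ → ℝ, IsPLF h ∧ h ∘ f ∘ Function.invFun h = g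

/-- A corner function: a member of `𝓕` (with at least one node) all of whose nodes
lie in `[x_f, f x_f)`. -/
def CornerFun (f : ℝ → ℝ) : Prop :=
  MemF f ∧ HasNode f ∧ ∀ x, IsNode f x → x ∈ Set.Ico (firstNode f) (f (firstNode f))

/-- `f` is affine with slope `a` on a left neighbourhood of `x` and affine with slope `b` on a
right neighbourhood of `x`, and takes the value `f x` of both pieces at `x`. -/
structure HasSlopesAt (f : ℝ → ℝ) (x a b : ℝ) : Prop where
  left : ∀ᶠ y in nhdsWithin x (Set.Iic x), f y = f x + a * (y - x)
  right : ∀ᶠ y in nhdsWithin x (Set.Ici x), f y = f x + b * (y - x)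

namespace HasSlopesAt

variable {f g : ℝ → ℝ} {x a b c d : ℝ}

theorem leftDeriv_eq (hf : HasSlopesAt f x a b) : leftDeriv f x = a := by
  have h1 : HasDerivAt (fun y : ℝ => f x + a * (y - x)) a x := by
    simpa using (((hasDerivAt_id x).sub_const x).const_mul a).const_add (f x)
  exact (h1.hasDerivWithinAt.congr_of_eventuallyEq hf.left (by simp)).derivWithin
    (uniqueDiffOn_Iic x x self_mem_Iic)

theorem rightDeriv_eq (hf : HasSlopesAt f x a b) : rightDeriv f x = b := by
  have h1 : HasDerivAt (fun y : ℝ => f x + b * (y - x)) b x := by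
    simpa using (((hasDerivAt_id x).sub_const x).const_mul b).const_add (f x)
  exact (h1.hasDerivWithinAt.congr_of_eventuallyEq hf.right (by simp)).derivWithin
    (uniqueDiffOn_Ici x x self_mem_Ici)

theorem fstar_eq (hf : HasSlopesAt f x a b) : fstar f x = b / a := by
  rw [fstar, hf.leftDeriv_eq, hf.rightDeriv_eq]

theorem locallyAffineAt_iff (hf : HasSlopesAt f x a b) : LocallyAffineAt f x ↔ a = b := by
  constructor
  · rintro ⟨α, β, hαβ⟩
    have hx := hαβ.self_of_nhds
    have key : ∀ᶠ y in nhds x, f y = f x + α * (y - x) := by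
      filter_upwards [hαβ] with y hy
      rw [hy, hx]
      ring
    have hα : HasSlopesAt f x α α :=
      ⟨key.filter_mono nhdsWithin_le_nhds, key.filter_mono nhdsWithin_le_nhds⟩
    rw [← hf.leftDeriv_eq, ← hf.rightDeriv_eq, hα.leftDeriv_eq, hα.rightDeriv_eq]
  · rintro rfl
    refine ⟨a, f x - a * x, ?_⟩
    have key : ∀ᶠ y in nhds x, f y = f x + a * (y - x) := by
      rw [← nhdsLE_sup_nhdsGE]
      exact Filter.eventually_sup.2 ⟨hf.left, hf.right⟩
    filter_upwards [key] with y hy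
    rw [hy]
    ring

theorem comp (hg : HasSlopesAt g (f x) c d) (hf : HasSlopesAt f x a b) (hm : Monotone f)
    (hc : Continuous f) : HasSlopesAt (g ∘ f) x (c * a) (d * b) := by
  constructor
  · have ht : Filter.Tendsto f (nhdsWithin x (Iic x)) (nhdsWithin (f x) (Iic (f x))) :=
      hc.continuousWithinAt.tendsto_nhdsWithin fun y hy => hm hy
    filter_upwards [hf.left, ht.eventually hg.left] with y h1 h2
    rw [comp_apply, comp_apply, h2, h1]
    ring
  · have ht : Filter.Tendsto f (nhdsWithin x (Ici x)) (nhdsWithin (f x) (Ici (f x))) :=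
      hc.continuousWithinAt.tendsto_nhdsWithin fun y hy => hm hy
    filter_upwards [hf.right, ht.eventually hg.right] with y h1 h2
    rw [comp_apply, comp_apply, h2, h1]
    ring

theorem symm {e : ℝ ≃o ℝ} (he : HasSlopesAt e x a b) (ha : a ≠ 0) (hb : b ≠ 0) :
    HasSlopesAt e.symm (e x) a⁻¹ b⁻¹ := by
  have hx : e.symm (e x) = x := e.symm_apply_apply x
  constructor
  · have ht : Filter.Tendsto e.symm (nhdsWithin (e x) (Iic (e x))) (nhdsWithin x (Iic x)) := by
      have := e.symm.continuous.continuousWithinAt.tendsto_nhdsWithin (x := e x)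
        (s := Iic (e x)) (t := Iic x) fun y hy => (e.symm_apply_le).2 hy
      rwa [hx] at this
    filter_upwards [ht.eventually he.left] with y hy
    rw [e.apply_symm_apply] at hy
    rw [hx, sub_eq_of_eq_add' hy, inv_mul_cancel_left₀ ha]
    ring
  · have ht : Filter.Tendsto e.symm (nhdsWithin (e x) (Ici (e x))) (nhdsWithin x (Ici x)) := by
      have := e.symm.continuous.continuousWithinAt.tendsto_nhdsWithin (x := e x)
        (s := Ici (e x)) (t := Ici x) fun y hy => (e.le_symm_apply).2 hy
      rwa [hx] at this
    filter_upwards [ht.eventually he.right] with y hy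
    rw [e.apply_symm_apply] at hy
    rw [hx, sub_eq_of_eq_add' hy, inv_mul_cancel_left₀ hb]
    ring

end HasSlopesAt

/-- A function that is locally affine at each point of an open interval is affine on it. -/
theorem exists_affine_of_locallyAffineAt_Ioo {f : ℝ → ℝ} {u v : ℝ}
    (hf : ∀ x ∈ Ioo u v, LocallyAffineAt f x) :
    ∃ a b : ℝ, ∀ x ∈ Ioo u v, f x = a * x + b := by
  have key : ∀ x ∈ Ioo u v, DifferentiableAt ℝ f x ∧ HasDerivAt (deriv f) 0 x := by
    intro x hx
    obtain ⟨a, b, hab⟩ := hf x hx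
    have haff : ∀ y : ℝ, HasDerivAt (fun t : ℝ => a * t + b) a y := fun y => by
      simpa using ((hasDerivAt_id y).const_mul a).add_const b
    have hev : f =ᶠ[nhds x] fun t => a * t + b := hab
    refine ⟨((haff x).congr_of_eventuallyEq hev).differentiableAt, ?_⟩
    refine (hasDerivAt_const x a).congr_of_eventuallyEq ?_
    filter_upwards [hev.deriv] with y hy
    rw [hy, (haff y).deriv]
  have const : ∀ k : ℝ → ℝ, (∀ x ∈ Ioo u v, HasDerivAt k 0 x) →
      ∃ c, ∀ x ∈ Ioo u v, k x = c := fun k hk =>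
    isOpen_Ioo.exists_is_const_of_deriv_eq_zero isPreconnected_Ioo
      (fun x hx => (hk x hx).differentiableAt.differentiableWithinAt)
      (fun x hx => (hk x hx).deriv)
  obtain ⟨a, ha⟩ := const _ fun x hx => (key x hx).2
  obtain ⟨b, hb⟩ := const (fun x => f x - a * x) fun x hx => by
    have h1 := (key x hx).1.hasDerivAt
    rw [ha x hx] at h1
    simpa using h1.fun_sub ((hasDerivAt_id x).const_mul a)
  exact ⟨a, b, fun x hx => by rw [← hb x hx]; ring⟩

/-- A continuous strictly increasing function that is locally affine at each point of an open
interval is affine with positive slope on its closure. -/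
theorem exists_affine_of_locallyAffineAt_Icc {f : ℝ → ℝ} {u v : ℝ} (huv : u < v)
    (hc : Continuous f) (hm : StrictMono f) (hf : ∀ x ∈ Ioo u v, LocallyAffineAt f x) :
    ∃ a b : ℝ, 0 < a ∧ ∀ x ∈ Icc u v, f x = a * x + b := by
  obtain ⟨a, b, hab⟩ := exists_affine_of_locallyAffineAt_Ioo hf
  have hcl : ∀ x ∈ Icc u v, f x = a * x + b := by
    rw [← closure_Ioo huv.ne]
    have : EqOn f (fun x => a * x + b) (Ioo u v) := hab
    exact this.closure hc (by fun_prop)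
  refine ⟨a, b, ?_, hcl⟩
  have h1 := hm huv
  rw [hcl u ⟨le_rfl, huv.le⟩, hcl v ⟨huv.le, le_rfl⟩] at h1
  by_contra! h2
  nlinarith

namespace IsPLF

variable {f : ℝ → ℝ}

theorem mem_Icc_apply (hf : IsPLF f) {x : ℝ} (hx : x ∈ Icc (0 : ℝ) 1) : f x ∈ Icc (0 : ℝ) 1 := by
  have h0 := hf.strictMonoOn.monotoneOn (by simp) hx hx.1
  have h1 := hf.strictMonoOn.monotoneOn hx (by simp) hx.2
  rw [hf.map_zero] at h0
  rw [hf.map_one] at h1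
  exact ⟨h0, h1⟩

theorem strictMono (hf : IsPLF f) : StrictMono f := by
  intro x y hxy
  by_cases hx : x ∈ Icc (0 : ℝ) 1 <;> by_cases hy : y ∈ Icc (0 : ℝ) 1
  · exact hf.strictMonoOn hx hy hxy
  · rw [hf.eq_id y hy]
    have := hf.mem_Icc_apply hx
    simp only [mem_Icc] at *
    grind
  · rw [hf.eq_id x hx]
    have := hf.mem_Icc_apply hy
    simp only [mem_Icc] at *
    grind
  · rwa [hf.eq_id x hx, hf.eq_id y hy]

theorem surjective (hf : IsPLF f) : Surjective f := by
  intro y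
  by_cases hy : y ∈ Icc (0 : ℝ) 1
  · obtain ⟨x, -, hx⟩ := hf.surjOn hy
    exact ⟨x, hx⟩
  · exact ⟨y, hf.eq_id y hy⟩

theorem exists_orderIso (hf : IsPLF f) : ∃ e : ℝ ≃o ℝ, ⇑e = f :=
  ⟨hf.strictMono.orderIsoOfSurjective f hf.surjective, rfl⟩

theorem apply_mem_Ioo_iff (hf : IsPLF f) {x : ℝ} : f x ∈ Ioo (0 : ℝ) 1 ↔ x ∈ Ioo (0 : ℝ) 1 := by
  have h0 := hf.strictMono.lt_iff_lt (a := 0) (b := x)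
  have h1 := hf.strictMono.lt_iff_lt (a := x) (b := 1)
  rw [hf.map_zero] at h0
  rw [hf.map_one] at h1
  rw [mem_Ioo, mem_Ioo, h0, h1]

theorem of_orderIso (e : ℝ ≃o ℝ) (h0 : e 0 = 0) (h1 : e 1 = 1)
    (hid : ∀ x : ℝ, x ∉ Icc (0 : ℝ) 1 → e x = x) (hn : {x : ℝ | IsNode e x}.Finite) :
    IsPLF e where
  map_zero := h0
  map_one := h1
  strictMonoOn := e.strictMono.strictMonoOn _
  continuousOn := e.continuous.continuousOn
  surjOn := by
    intro y hy
    refine ⟨e.symm y, ⟨?_, ?_⟩, e.apply_symm_apply y⟩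
    · rw [e.le_symm_apply, h0]
      exact hy.1
    · rw [e.symm_apply_le, h1]
      exact hy.2
  eq_id := hid
  finite_nodes := hn

theorem exists_hasSlopesAt (hf : IsPLF f) {x : ℝ} (hx : x ∈ Ioo (0 : ℝ) 1) :
    ∃ a b : ℝ, 0 < a ∧ 0 < b ∧ HasSlopesAt f x a b := by
  have hc : Continuous f := by
    obtain ⟨e, rfl⟩ := hf.exists_orderIso
    exact e.continuous
  have hev : ∀ᶠ y in nhds x, y ∈ Ioo (0 : ℝ) 1 ∧ y ∉ {t | IsNode f t} \ {x} :=
    (isOpen_Ioo.eventually_mem hx).and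
      ((hf.finite_nodes.subset sdiff_subset).isClosed.isOpen_compl.eventually_mem (by simp))
  obtain ⟨ε, hε, hball⟩ := Metric.eventually_nhds_iff.1 hev
  have haff : ∀ y, y ≠ x → |y - x| < ε → LocallyAffineAt f y := by
    intro y hne hy
    obtain ⟨h1, h2⟩ := hball (y := y) (by rwa [Real.dist_eq])
    by_contra h3
    exact h2 ⟨⟨h1, h3⟩, hne⟩
  obtain ⟨a, a', ha, hl⟩ := exists_affine_of_locallyAffineAt_Icc (u := x - ε) (v := x)
    (by linarith) hc hf.strictMono fun y hy =>
      haff y hy.2.ne (abs_lt.2 ⟨by linarith [hy.1], by linarith [hy.2]⟩)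
  obtain ⟨b, b', hb, hr⟩ := exists_affine_of_locallyAffineAt_Icc (u := x) (v := x + ε)
    (by linarith) hc hf.strictMono fun y hy =>
      haff y hy.1.ne' (abs_lt.2 ⟨by linarith [hy.1], by linarith [hy.2]⟩)
  refine ⟨a, b, ha, hb, ?_, ?_⟩
  · filter_upwards [Icc_mem_nhdsLE (show x - ε < x by linarith)] with y hy
    rw [hl y hy, hl x ⟨by linarith, le_rfl⟩]
    ring
  · filter_upwards [Icc_mem_nhdsGE (show x < x + ε by linarith)] with y hy
    rw [hr y hy, hr x ⟨le_rfl, by linarith⟩]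
    ring

theorem isNode_iff_fstar_ne_one (hf : IsPLF f) {x : ℝ} (hx : x ∈ Ioo (0 : ℝ) 1) :
    IsNode f x ↔ fstar f x ≠ 1 := by
  obtain ⟨a, b, ha, -, hs⟩ := hf.exists_hasSlopesAt hx
  rw [IsNode, hs.locallyAffineAt_iff, hs.fstar_eq, Ne, div_eq_one_iff_eq ha.ne']
  simp [mem_Ioo.1 hx, eq_comm]

theorem fstar_pos (hf : IsPLF f) {x : ℝ} (hx : x ∈ Ioo (0 : ℝ) 1) : 0 < fstar f x := by
  obtain ⟨a, b, ha, hb, hs⟩ := hf.exists_hasSlopesAt hx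
  rw [hs.fstar_eq]
  exact div_pos hb ha

end IsPLF

/-- The cocycle rule for `f*` under conjugation, together with the resulting node criterion. -/
theorem isNode_conj_iff_and_fstar_conj {f h : ℝ ≃o ℝ} (hf : IsPLF f) (hh : IsPLF h) {x : ℝ}
    (hx : x ∈ Ioo (0 : ℝ) 1) :
    (IsNode (h ∘ f ∘ h.symm) (h x) ↔ fstar (h ∘ f ∘ h.symm) (h x) ≠ 1) ∧
    fstar (h ∘ f ∘ h.symm) (h x) = fstar h (f x) * fstar f x / fstar h x := by
  obtain ⟨a, b, ha, hb, hs⟩ := hf.exists_hasSlopesAt hx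
  obtain ⟨c, d, hc, hd, ht⟩ := hh.exists_hasSlopesAt hx
  obtain ⟨k, l, hk, hl, hu⟩ := hh.exists_hasSlopesAt (hf.apply_mem_Ioo_iff.2 hx)
  have hx' : h.symm (h x) = x := h.symm_apply_apply x
  have h1 := ht.symm hc.ne' hd.ne'
  have hfs : HasSlopesAt f (h.symm (h x)) a b := by rwa [hx']
  have h2 := hfs.comp h1 h.symm.monotone h.symm.continuous
  have hus : HasSlopesAt h ((f ∘ h.symm) (h x)) k l := by rwa [comp_apply, hx']
  have h3 := hus.comp h2 (f.monotone.comp h.symm.monotone) (f.continuous.comp h.symm.continuous)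
  constructor
  · rw [IsNode, h3.locallyAffineAt_iff, h3.fstar_eq, Ne, div_eq_one_iff_eq (by positivity)]
    simp [mem_Ioo.1 (hh.apply_mem_Ioo_iff.2 hx), eq_comm]
  · rw [h3.fstar_eq, hu.fstar_eq, hs.fstar_eq, ht.fstar_eq]
    field_simp

theorem firstNode_eq_of_isLeast {f : ℝ → ℝ} {x : ℝ} (h : IsLeast {t | IsNode f t} x) :
    firstNode f = x :=
  h.csInf_eq

/-- Elementary conjugation of a corner function `f` with nodes `z₀ < ⋯ < z_{m-1}` by the
map `h` with single node `z_{m-1}` and `h*(z_{m-1}) = f*(z_{m-1})` yields a corner function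
`g = h f h⁻¹` whose nodes, in increasing order, are `h (f⁻¹ z_{m-1}), h z₀, …, h z_{m-2}`:
the last node of `f` becomes the first node of `g`, the other nodes shift one place to
the right, and the node values `f*(z₀), …, f*(z_{m-1})` are unchanged. -/
theorem elementary_conjugation_corner (f h g : ℝ → ℝ) (hf : CornerFun f)
    (m : ℕ) (hm : 1 ≤ m) (z : ℕ → ℝ)
    (hmono : ∀ i j, i < j → j < m → z i < z j)
    (hz : {x | IsNode f x} = z '' Set.Iio m)
    (hh : IsPLF h) (hhn : ∀ x : ℝ, IsNode h x ↔ x = z (m - 1))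
    (hhs : fstar h (z (m - 1)) = fstar f (z (m - 1)))
    (hg : g = h ∘ f ∘ Function.invFun h) :
    CornerFun g ∧
    {x | IsNode g x} =
      insert (h (Function.invFun f (z (m - 1)))) ((h ∘ z) '' Set.Iio (m - 1)) ∧
    (∀ i < m - 1, h (Function.invFun f (z (m - 1))) < h (z i)) ∧
    fstar g (h (Function.invFun f (z (m - 1)))) = fstar f (z (m - 1)) ∧
    (∀ i < m - 1, fstar g (h (z i)) = fstar f (z i)) := by
  obtain ⟨⟨hfP, hfgt⟩, -, hcorner⟩ := hf
  obtain ⟨f, rfl⟩ := hfP.exists_orderIso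
  obtain ⟨h, rfl⟩ := hh.exists_orderIso
  have hinv : ∀ e : ℝ ≃o ℝ, invFun e = e.symm := fun e =>
    funext fun y => e.injective (by
      rw [e.apply_symm_apply]; exact invFun_eq (e.surjective y))
  rw [hinv] at hg ⊢
  set p := z (m - 1) with hp
  set q := f.symm p with hq
  have hfq : f q = p := f.apply_symm_apply p
  have hnode : ∀ i < m, IsNode f (z i) := fun i hi => by
    have : z i ∈ {x | IsNode f x} := hz ▸ ⟨i, hi, rfl⟩
    exact this
  have hpn : IsNode f p := hnode _ (by omega)
  have hz01 : ∀ i < m, z i ∈ Ioo (0 : ℝ) 1 := fun i hi => (hnode i hi).1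
  have hmono' : ∀ i < m, z 0 ≤ z i := fun i hi => by
    rcases Nat.eq_zero_or_pos i with rfl | hi0
    · exact le_rfl
    · exact (hmono 0 i hi0 hi).le
  have hfirst : firstNode f = z 0 := firstNode_eq_of_isLeast
    ⟨hnode 0 hm, by
      rw [hz]
      rintro _ ⟨i, hi, rfl⟩
      exact hmono' i hi⟩
  have hp_lt : p < f (z 0) := by
    have := (hcorner p hpn).2
    rwa [hfirst] at this
  have hq_lt : q < z 0 := by
    rw [← f.lt_iff_lt, hfq]
    exact hp_lt
  have hq01 : q ∈ Ioo (0 : ℝ) 1 := hfP.apply_mem_Ioo_iff.1 (hfq ▸ hpn.1)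
  have hqp : q < p := by
    have := hfgt q hq01
    rwa [hfq] at this
  have hf_one : ∀ x ∈ Ioo (0 : ℝ) 1, ¬ IsNode f x → fstar f x = 1 := fun x hx hn => by
    by_contra hne
    exact hn ((hfP.isNode_iff_fstar_ne_one hx).2 hne)
  have hh_one : ∀ x ∈ Ioo (0 : ℝ) 1, x ≠ p → fstar h x = 1 := fun x hx hn => by
    by_contra hne
    exact hn ((hhn x).1 ((hh.isNode_iff_fstar_ne_one hx).2 hne))
  have hconj : ∀ x ∈ Ioo (0 : ℝ) 1, (IsNode g (h x) ↔ fstar g (h x) ≠ 1) ∧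
      fstar g (h x) = fstar h (f x) * fstar f x / fstar h x := fun x hx => by
    rw [hg]
    exact isNode_conj_iff_and_fstar_conj hfP hh hx
  have hstar_q : fstar g (h q) = fstar f p := by
    rw [(hconj q hq01).2, hfq, hh_one q hq01 hqp.ne, hf_one q hq01, hhs]
    · simp
    · intro hn
      have := (hcorner q hn).1
      rw [hfirst] at this
      linarith
  have hstar_p : fstar g (h p) = 1 := by
    rw [(hconj p hpn.1).2, hhs, hh_one (f p) (hfP.apply_mem_Ioo_iff.2 hpn.1)
      (hfgt p hpn.1).ne', one_mul]
    exact div_self (hfP.fstar_pos hpn.1).ne'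
  have hstar : ∀ x ∈ Ioo (0 : ℝ) 1, x ≠ p → x ≠ q → fstar g (h x) = fstar f x := by
    intro x hx hxp hxq
    have hfx : f x ≠ p := fun hfx => hxq (by rw [hq, ← hfx, f.symm_apply_apply])
    rw [(hconj x hx).2, hh_one _ (hfP.apply_mem_Ioo_iff.2 hx) hfx, hh_one x hx hxp]
    simp
  have hz_lt : ∀ i < m - 1, z i < p := fun i hi => hmono i _ hi (by omega)
  have hq_lt_z : ∀ i < m - 1, q < z i := fun i hi => hq_lt.trans_le (hmono' i (by omega))
  have hstar_z : ∀ i < m - 1, fstar g (h (z i)) = fstar f (z i) := fun i hi =>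
    hstar _ (hz01 i (by omega)) (hz_lt i hi).ne (hq_lt_z i hi).ne'
  have hq_node : IsNode g (h q) := by
    rw [(hconj q hq01).1, hstar_q]
    exact (hfP.isNode_iff_fstar_ne_one hpn.1).1 hpn
  have hnodes : {x | IsNode g x} = insert (h q) ((h ∘ z) '' Iio (m - 1)) := by
    ext y
    constructor
    · intro hy
      obtain ⟨x, rfl⟩ := h.surjective y
      have hx : x ∈ Ioo (0 : ℝ) 1 := hh.apply_mem_Ioo_iff.1 hy.1
      have hne := (hconj x hx).1.1 hy
      by_cases hxq : x = q
      · exact Or.inl (by rw [hxq])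
      have hxp : x ≠ p := fun hxp => hne (by rw [hxp, hstar_p])
      rw [hstar x hx hxp hxq, ← hfP.isNode_iff_fstar_ne_one hx] at hne
      obtain ⟨i, hi, rfl⟩ : x ∈ z '' Iio m := hz ▸ hne
      refine Or.inr ⟨i, ?_, rfl⟩
      have him : i ≠ m - 1 := fun him => hxp (by rw [hp, him])
      simp only [mem_Iio] at hi ⊢
      omega
    · rintro (rfl | ⟨i, hi, rfl⟩)
      · exact hq_node
      · have hi' : i < m - 1 := hi
        have hi01 := hz01 i (by omega)
        have := (hfP.isNode_iff_fstar_ne_one hi01).1 (hnode i (by omega))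
        exact (hconj _ hi01).1.2 (by rwa [hstar_z i hi'])
  have hlt : ∀ i < m - 1, h q < h (z i) := fun i hi => h.strictMono (hq_lt_z i hi)
  have hleast : firstNode g = h q := firstNode_eq_of_isLeast
    ⟨hq_node, by
      rw [hnodes]
      rintro _ (rfl | ⟨i, hi, rfl⟩)
      · exact le_rfl
      · exact (hlt i hi).le⟩
  have hgh : ∀ x, g (h x) = h (f x) := fun x => by simp [hg]
  have hgP : IsPLF g := by
    have hge : g = ⇑((h.symm.trans f).trans h) := hg
    have hgy : ∀ x y, h x = y → f x = x → g y = y := by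
      rintro x _ rfl hx
      rw [hgh, hx]
    have hfin : {x | IsNode g x}.Finite := by
      rw [hnodes]
      exact ((finite_Iio _).image _).insert _
    rw [hge] at hgy hfin ⊢
    exact IsPLF.of_orderIso _ (hgy 0 0 hh.map_zero hfP.map_zero) (hgy 1 1 hh.map_one hfP.map_one)
      (fun x hx => hgy x x (hh.eq_id x hx) (hfP.eq_id x hx)) hfin
  refine ⟨⟨⟨hgP, ?_⟩, ⟨_, hq_node⟩, ?_⟩, hnodes, hlt, hstar_q, hstar_z⟩
  · intro y hy
    obtain ⟨x, rfl⟩ := h.surjective y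
    rw [hgh]
    exact h.strictMono (hfgt x (hh.apply_mem_Ioo_iff.1 hy))
  · intro y hy
    rw [hleast, hgh, hfq]
    obtain rfl | ⟨i, hi, rfl⟩ : y ∈ insert (h q) ((h ∘ z) '' Iio (m - 1)) := hnodes ▸ hy
    · exact ⟨le_rfl, h.strictMono hqp⟩
    · exact ⟨(hlt i hi).le, h.strictMono (hz_lt i hi)⟩
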